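/- arXiv:1208.5230 — 2 statements merged into one kernel-verified Lean document; each statement's English description precedes it below -/
import Mathlib

section
/- At every point of ℂ² where h ≠ 0, one has 2i·(c₁·Tu₂ − c₂·Tu₁) = (2/h²)·(b₁b₂²·|u₁|² + b₁²b₂·|u₂|² − 2a₁b₂²·conj(u₁)² − 2a₂b₁²·conj(u₂)²). -/
open Complex ComplexConjugate

noncomputable section

/-- Wirtinger derivative `∂f/∂z₁ = (1/2)(∂f/∂x₁ − i·∂f/∂y₁)`. -/
def dz1 (f : ℂ × ℂ → ℂ) (p : ℂ × ℂ) : ℂ :=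
  (1 / 2) * (fderiv ℝ f p (1, 0) - Complex.I * fderiv ℝ f p (Complex.I, 0))

/-- Wirtinger derivative `∂f/∂z₂ = (1/2)(∂f/∂x₂ − i·∂f/∂y₂)`. -/
def dz2 (f : ℂ × ℂ → ℂ) (p : ℂ × ℂ) : ℂ :=
  (1 / 2) * (fderiv ℝ f p (0, 1) - Complex.I * fderiv ℝ f p (0, Complex.I))

/-- Wirtinger derivative `∂f/∂z̄₁ = (1/2)(∂f/∂x₁ + i·∂f/∂y₁)`. -/
def dzbar1 (f : ℂ × ℂ → ℂ) (p : ℂ × ℂ) : ℂ :=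
  (1 / 2) * (fderiv ℝ f p (1, 0) + Complex.I * fderiv ℝ f p (Complex.I, 0))

/-- Wirtinger derivative `∂f/∂z̄₂ = (1/2)(∂f/∂x₂ + i·∂f/∂y₂)`. -/
def dzbar2 (f : ℂ × ℂ → ℂ) (p : ℂ × ℂ) : ℂ :=
  (1 / 2) * (fderiv ℝ f p (0, 1) + Complex.I * fderiv ℝ f p (0, Complex.I))

/-- The ellipsoid defining function
`u(z₁,z₂) = b₁|z₁|² + b₂|z₂|² + 2a₁Re(z₁²) + 2a₂Re(z₂²) − 1`. -/
def uDef (a₁ a₂ b₁ b₂ : ℝ) (p : ℂ × ℂ) : ℝ :=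
  b₁ * Complex.normSq p.1 + b₂ * Complex.normSq p.2
    + 2 * a₁ * (p.1 ^ 2).re + 2 * a₂ * (p.2 ^ 2).re - 1

/-- `u₁ = ∂u/∂z₁ = b₁·conj z₁ + 2a₁z₁`. -/
def u1 (a₁ b₁ : ℝ) (p : ℂ × ℂ) : ℂ := b₁ * conj p.1 + 2 * a₁ * p.1

/-- `u₂ = ∂u/∂z₂ = b₂·conj z₂ + 2a₂z₂`. -/
def u2 (a₂ b₂ : ℝ) (p : ℂ × ℂ) : ℂ := b₂ * conj p.2 + 2 * a₂ * p.2

/-- The Levi form `h = b₁|u₂|² + b₂|u₁|²` of the ellipsoid. -/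
def hLevi (a₁ a₂ b₁ b₂ : ℝ) (p : ℂ × ℂ) : ℝ :=
  b₁ * Complex.normSq (u2 a₂ b₂ p) + b₂ * Complex.normSq (u1 a₁ b₁ p)

/-- The characteristic vector field
`Tf = (i/h)(b₂·conj(u₁)·∂f/∂z₁ + b₁·conj(u₂)·∂f/∂z₂) − (i/h)(b₂·u₁·∂f/∂z̄₁ + b₁·u₂·∂f/∂z̄₂)`. -/
def Tchar (a₁ a₂ b₁ b₂ : ℝ) (f : ℂ × ℂ → ℂ) (p : ℂ × ℂ) : ℂ :=
  (Complex.I / (hLevi a₁ a₂ b₁ b₂ p : ℂ)) *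
      ((b₂ : ℂ) * conj (u1 a₁ b₁ p) * dz1 f p + (b₁ : ℂ) * conj (u2 a₂ b₂ p) * dz2 f p)
    - (Complex.I / (hLevi a₁ a₂ b₁ b₂ p : ℂ)) *
      ((b₂ : ℂ) * u1 a₁ b₁ p * dzbar1 f p + (b₁ : ℂ) * u2 a₂ b₂ p * dzbar2 f p)

/-- `c₁ = b₁·conj(u₂)/h`. -/
def c1 (a₁ a₂ b₁ b₂ : ℝ) (p : ℂ × ℂ) : ℂ :=
  (b₁ : ℂ) * conj (u2 a₂ b₂ p) / (hLevi a₁ a₂ b₁ b₂ p : ℂ)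

/-- `c₂ = −b₂·conj(u₁)/h`. -/
def c2 (a₁ a₂ b₁ b₂ : ℝ) (p : ℂ × ℂ) : ℂ :=
  -((b₂ : ℂ) * conj (u1 a₁ b₁ p)) / (hLevi a₁ a₂ b₁ b₂ p : ℂ)

/-- The real derivative of `p ↦ b·conj (L p) + 2a·L p` for a continuous real-linear `L`. -/
theorem fderiv_conj_add_apply (a b : ℝ) (L : ℂ × ℂ →L[ℝ] ℂ) (p v : ℂ × ℂ) :
    fderiv ℝ (fun q => (b : ℂ) * conj (L q) + 2 * (a : ℂ) * L q) p v
      = b * conj (L v) + 2 * a * L v := by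
  have hL : HasFDerivAt (fun q => L q) L p := L.hasFDerivAt
  have hc : HasFDerivAt (fun q => conj (L q)) ((conjCLE : ℂ →L[ℝ] ℂ).comp L) p :=
    ((conjCLE : ℂ →L[ℝ] ℂ).comp L).hasFDerivAt
  rw [((hc.const_mul (b : ℂ)).fun_add (hL.const_mul (2 * (a : ℂ)))).fderiv]
  simp

theorem fderiv_u1_apply (a b : ℝ) (p v : ℂ × ℂ) :
    fderiv ℝ (u1 a b) p v = b * conj v.1 + 2 * a * v.1 :=
  fderiv_conj_add_apply a b (ContinuousLinearMap.fst ℝ ℂ ℂ) p v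

theorem fderiv_u2_apply (a b : ℝ) (p v : ℂ × ℂ) :
    fderiv ℝ (u2 a b) p v = b * conj v.2 + 2 * a * v.2 :=
  fderiv_conj_add_apply a b (ContinuousLinearMap.snd ℝ ℂ ℂ) p v

theorem Tchar_u1 (a₁ a₂ b₁ b₂ : ℝ) (p : ℂ × ℂ) :
    Tchar a₁ a₂ b₁ b₂ (u1 a₁ b₁) p = Complex.I / (hLevi a₁ a₂ b₁ b₂ p : ℂ) *
      (b₂ * (2 * a₁ * conj (u1 a₁ b₁ p) - b₁ * u1 a₁ b₁ p)) := by
  simp only [Tchar, dz1, dz2, dzbar1, dzbar2, fderiv_u1_apply, map_one, map_zero, conj_I]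
  ring_nf
  simp only [I_pow_three]
  ring

theorem Tchar_u2 (a₁ a₂ b₁ b₂ : ℝ) (p : ℂ × ℂ) :
    Tchar a₁ a₂ b₁ b₂ (u2 a₂ b₂) p = Complex.I / (hLevi a₁ a₂ b₁ b₂ p : ℂ) *
      (b₁ * (2 * a₂ * conj (u2 a₂ b₂ p) - b₂ * u2 a₂ b₂ p)) := by
  simp only [Tchar, dz1, dz2, dzbar1, dzbar2, fderiv_u2_apply, map_one, map_zero, conj_I]
  ring_nf
  simp only [I_pow_three]
  ring

/-- At points where `h ≠ 0`:
`2i(c₁·Tu₂ − c₂·Tu₁) = (2/h²)(b₁b₂²|u₁|² + b₁²b₂|u₂|² − 2a₁b₂²(conj u₁)² − 2a₂b₁²(conj u₂)²)`. -/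
theorem ellipsoid_T_curvature_term
    (A₁ B₁ A₂ B₂ a₁ a₂ b₁ b₂ : ℝ)
    (hA₁ : 0 < A₁) (hB₁ : 0 < B₁) (hA₂ : 0 < A₂) (hB₂ : 0 < B₂)
    (ha₁ : a₁ = (A₁ - B₁) / 4) (ha₂ : a₂ = (A₂ - B₂) / 4)
    (hb₁ : b₁ = (A₁ + B₁) / 2) (hb₂ : b₂ = (A₂ + B₂) / 2) :
    ∀ p : ℂ × ℂ, hLevi a₁ a₂ b₁ b₂ p ≠ 0 →
      2 * Complex.I *
          (c1 a₁ a₂ b₁ b₂ p * Tchar a₁ a₂ b₁ b₂ (u2 a₂ b₂) p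
            - c2 a₁ a₂ b₁ b₂ p * Tchar a₁ a₂ b₁ b₂ (u1 a₁ b₁) p)
        = (2 / (hLevi a₁ a₂ b₁ b₂ p : ℂ) ^ 2) *
            ((b₁ : ℂ) * (b₂ : ℂ) ^ 2 * (Complex.normSq (u1 a₁ b₁ p) : ℂ)
              + (b₁ : ℂ) ^ 2 * (b₂ : ℂ) * (Complex.normSq (u2 a₂ b₂ p) : ℂ)
              - 2 * (a₁ : ℂ) * (b₂ : ℂ) ^ 2 * (conj (u1 a₁ b₁ p)) ^ 2
              - 2 * (a₂ : ℂ) * (b₁ : ℂ) ^ 2 * (conj (u2 a₂ b₂ p)) ^ 2) := by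
  intro p _
  rw [Tchar_u1, Tchar_u2, c1, c2, normSq_eq_conj_mul_self, normSq_eq_conj_mul_self]
  ring_nf
  simp only [I_sq]
  ring
end
end

section
/- At every point of ℂ² where h ≠ 0, one has (c₂·Z₁̄Z₁u₁ − c₁·Z₁̄Z₁u₂)/h = (2a₁b₂²·conj(u₁)² + 2a₂b₁²·conj(u₂)²)/h². -/
open Complex ComplexConjugate

noncomputable section

/-- The CR vector field `Z₁f = u₂·∂f/∂z₁ − u₁·∂f/∂z₂`. -/
def Z1 (a₁ a₂ b₁ b₂ : ℝ) (f : ℂ × ℂ → ℂ) (p : ℂ × ℂ) : ℂ :=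
  u2 a₂ b₂ p * dz1 f p - u1 a₁ b₁ p * dz2 f p

/-- The conjugate CR vector field `Z₁̄f = conj(u₂)·∂f/∂z̄₁ − conj(u₁)·∂f/∂z̄₂`. -/
def Zbar1 (a₁ a₂ b₁ b₂ : ℝ) (f : ℂ × ℂ → ℂ) (p : ℂ × ℂ) : ℂ :=
  conj (u2 a₂ b₂ p) * dzbar1 f p - conj (u1 a₁ b₁ p) * dzbar2 f p

theorem hasFDerivAt_u1 (a b : ℝ) (p : ℂ × ℂ) :
    HasFDerivAt (u1 a b)
      ((b : ℂ) • (conjCLE.toContinuousLinearMap.comp (ContinuousLinearMap.fst ℝ ℂ ℂ))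
        + (2 * a : ℂ) • ContinuousLinearMap.fst ℝ ℂ ℂ) p :=
  ContinuousLinearMap.hasFDerivAt
    ((b : ℂ) • (conjCLE.toContinuousLinearMap.comp (ContinuousLinearMap.fst ℝ ℂ ℂ))
      + (2 * a : ℂ) • ContinuousLinearMap.fst ℝ ℂ ℂ)

theorem hasFDerivAt_u2 (a b : ℝ) (p : ℂ × ℂ) :
    HasFDerivAt (u2 a b)
      ((b : ℂ) • (conjCLE.toContinuousLinearMap.comp (ContinuousLinearMap.snd ℝ ℂ ℂ))
        + (2 * a : ℂ) • ContinuousLinearMap.snd ℝ ℂ ℂ) p :=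
  ContinuousLinearMap.hasFDerivAt
    ((b : ℂ) • (conjCLE.toContinuousLinearMap.comp (ContinuousLinearMap.snd ℝ ℂ ℂ))
      + (2 * a : ℂ) • ContinuousLinearMap.snd ℝ ℂ ℂ)

theorem Z1_u1 (a₁ a₂ b₁ b₂ : ℝ) :
    Z1 a₁ a₂ b₁ b₂ (u1 a₁ b₁) = fun p => (2 * a₁ : ℂ) * u2 a₂ b₂ p := by
  funext p
  simp only [Z1, dz1, dz2, (hasFDerivAt_u1 a₁ b₁ p).fderiv]
  simp
  linear_combination (u2 a₂ b₂ p / 2 * (b₁ - 2 * a₁)) * Complex.I_mul_I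

theorem Z1_u2 (a₁ a₂ b₁ b₂ : ℝ) :
    Z1 a₁ a₂ b₁ b₂ (u2 a₂ b₂) = fun p => (-(2 * a₂) : ℂ) * u1 a₁ b₁ p := by
  funext p
  simp only [Z1, dz1, dz2, (hasFDerivAt_u2 a₂ b₂ p).fderiv]
  simp
  linear_combination (u1 a₁ b₁ p / 2 * (b₂ - 2 * a₂)) * Complex.I_mul_I

theorem Zbar1_const_mul_u1 (a₁ a₂ b₁ b₂ : ℝ) (c : ℂ) (p : ℂ × ℂ) :
    Zbar1 a₁ a₂ b₁ b₂ (fun q => c * u1 a₁ b₁ q) p = c * b₁ * conj (u2 a₂ b₂ p) := by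
  simp only [Zbar1, dzbar1, dzbar2, ((hasFDerivAt_u1 a₁ b₁ p).const_mul c).fderiv]
  simp
  linear_combination (-c * conj (u2 a₂ b₂ p) / 2 * (b₁ - 2 * a₁)) * Complex.I_mul_I

theorem Zbar1_const_mul_u2 (a₁ a₂ b₁ b₂ : ℝ) (c : ℂ) (p : ℂ × ℂ) :
    Zbar1 a₁ a₂ b₁ b₂ (fun q => c * u2 a₂ b₂ q) p = -(c * b₂ * conj (u1 a₁ b₁ p)) := by
  simp only [Zbar1, dzbar1, dzbar2, ((hasFDerivAt_u2 a₂ b₂ p).const_mul c).fderiv]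
  simp
  linear_combination (-c * conj (u1 a₁ b₁ p) / 2 * (b₂ - 2 * a₂)) * Complex.I_mul_I

/-- At points where `h ≠ 0`:
`(c₂·Z₁̄Z₁u₁ − c₁·Z₁̄Z₁u₂)/h = (2a₁b₂²(conj u₁)² + 2a₂b₁²(conj u₂)²)/h²`. -/
theorem ellipsoid_second_order_curvature_term
    (A₁ B₁ A₂ B₂ a₁ a₂ b₁ b₂ : ℝ)
    (hA₁ : 0 < A₁) (hB₁ : 0 < B₁) (hA₂ : 0 < A₂) (hB₂ : 0 < B₂)
    (ha₁ : a₁ = (A₁ - B₁) / 4) (ha₂ : a₂ = (A₂ - B₂) / 4)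
    (hb₁ : b₁ = (A₁ + B₁) / 2) (hb₂ : b₂ = (A₂ + B₂) / 2) :
    ∀ p : ℂ × ℂ, hLevi a₁ a₂ b₁ b₂ p ≠ 0 →
      (c2 a₁ a₂ b₁ b₂ p * Zbar1 a₁ a₂ b₁ b₂ (Z1 a₁ a₂ b₁ b₂ (u1 a₁ b₁)) p
          - c1 a₁ a₂ b₁ b₂ p * Zbar1 a₁ a₂ b₁ b₂ (Z1 a₁ a₂ b₁ b₂ (u2 a₂ b₂)) p)
          / (hLevi a₁ a₂ b₁ b₂ p : ℂ)
        = (2 * (a₁ : ℂ) * (b₂ : ℂ) ^ 2 * (conj (u1 a₁ b₁ p)) ^ 2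
            + 2 * (a₂ : ℂ) * (b₁ : ℂ) ^ 2 * (conj (u2 a₂ b₂ p)) ^ 2)
          / (hLevi a₁ a₂ b₁ b₂ p : ℂ) ^ 2 := by
  intro p hp
  rw [Z1_u1, Z1_u2, Zbar1_const_mul_u1, Zbar1_const_mul_u2, c1, c2]
  have hp' : (hLevi a₁ a₂ b₁ b₂ p : ℂ) ≠ 0 := Complex.ofReal_ne_zero.mpr hp
  field_simp
  ring
end
end
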